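/- Let α ∈ ℝ[t] be nonzero, let A ∈ ℍ[t] be nonzero and reduced with respect to i, and write A i Ā = F₁·i + F₂·j + F₃·k with F₁, F₂, F₃ ∈ ℝ[t]. Then the following two conditions are equivalent: (1) there exist μ ∈ ℝ[t] and b₁, b₂, b₃ ∈ ℝ[t] with α·b_m′ − α′·b_m = μ·F_m for m = 1, 2, 3, such that not all of b₁, b₂, b₃ are divisible by α (equivalently: the motion polynomial C = (α + εb)A with vectorial b = b₁·i + b₂·j + b₃·k is a framing motion whose origin trajectory −2b/α is a non-polynomial rational PH curve); (2) there exists z ∈ ℂ which is a root of α (viewed in ℂ[t]) of some multiplicity n ≥ 1 such that the n + 1 vectors v_i = (F₁⁽ⁱ⁾(z), F₂⁽ⁱ⁾(z), F₃⁽ⁱ⁾(z)) ∈ ℂ³, i = 0, 1, …, n, where F_m⁽ⁱ⁾ denotes the i-th formal derivative, are linearly dependent over ℂ. (Note that the linear dependence in (2) is automatic whenever n ≥ 3.) -/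

import Mathlib

open Polynomial

noncomputable section

/-- The quaternion unit `i`. -/
def qi : Quaternion ℝ := ⟨0, 1, 0, 0⟩
/-- The quaternion unit `j`. -/
def qj : Quaternion ℝ := ⟨0, 0, 1, 0⟩
/-- The quaternion unit `k`. -/
def qk : Quaternion ℝ := ⟨0, 0, 0, 1⟩

/-- Embedding of real polynomials into quaternion polynomials (scalar coefficients). -/
def toQ : Polynomial ℝ →+* Polynomial (Quaternion ℝ) :=
  mapRingHom (algebraMap ℝ (Quaternion ℝ))

/-- Embedding of real polynomials into complex polynomials. -/
def toC : Polynomial ℝ →+* Polynomial ℂ :=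
  mapRingHom (algebraMap ℝ ℂ)

/-- Coefficientwise quaternion conjugation of a quaternion polynomial. -/
def pconj (p : Polynomial (Quaternion ℝ)) : Polynomial (Quaternion ℝ) :=
  p.sum fun n a => monomial n (star a)

/-- `A ∈ ℍ[t]` is *reduced with respect to `i`* if it has no real polynomial factor of
positive degree and no right factor of positive degree all of whose coefficients lie in the
subalgebra of `ℍ` generated by `1` and `i`. -/
def ReducedWrtI (A : Polynomial (Quaternion ℝ)) : Prop :=
  (∀ ψ : Polynomial ℝ, ∀ A' : Polynomial (Quaternion ℝ), A = toQ ψ * A' → ψ.natDegree = 0) ∧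
  (∀ A' R : Polynomial (Quaternion ℝ), A = A' * R →
    (∀ n, (R.coeff n).imJ = 0 ∧ (R.coeff n).imK = 0) → R.natDegree = 0)

section LocalAnalysis

/-- A vector `F` has a residue relation of order `n` at `z` if the Laurent expansion of `r * F` at
`z` has zero residue for some nonzero `r = ∑ i ≤ n, c i * (X - z) ^ (-1 - i)`. -/
def HasResidueRelation {ι : Type*} (z : ℂ) (n : ℕ) (F : ι → ℂ[X]) : Prop :=
  ∃ c : ℕ → ℂ, (∃ i < n + 1, c i ≠ 0) ∧
    ∀ m, ∑ i ∈ Finset.range (n + 1), (taylor z (F m)).coeff i * c i = 0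

theorem hasResidueRelation_of_eval_eq_zero {ι : Type*} {z : ℂ} {F : ι → ℂ[X]} (n : ℕ)
    (hF : ∀ m, (F m).eval z = 0) : HasResidueRelation z n F := by
  refine ⟨Pi.single 0 1, ⟨0, by simp, by simp⟩, fun m => ?_⟩
  simp [Finset.sum_range_succ', hF, taylor_coeff_zero]

theorem factorial_mul_taylor_coeff (p : ℂ[X]) (z : ℂ) (k : ℕ) :
    (k.factorial : ℂ) * (taylor z p).coeff k = ((fun q => derivative q)^[k] p).eval z := by
  have h := congrFun (factorial_smul_hasseDeriv (R := ℂ) k) p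
  rw [taylor_coeff]
  change _ = eval z ((⇑derivative)^[k] p)
  rw [← h]
  simp

theorem hasResidueRelation_iff_not_linearIndependent (z : ℂ) (n : ℕ) (F₁ F₂ F₃ : ℂ[X]) :
    HasResidueRelation z n ![F₁, F₂, F₃] ↔
      ¬LinearIndependent ℂ (fun i : Fin (n + 1) =>
        ![((fun p => derivative p)^[(i : ℕ)] F₁).eval z,
          ((fun p => derivative p)^[(i : ℕ)] F₂).eval z,
          ((fun p => derivative p)^[(i : ℕ)] F₃).eval z]) := by
  have hfac (i : ℕ) : (i.factorial : ℂ) ≠ 0 := by exact_mod_cast i.factorial_ne_zero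
  simp only [← factorial_mul_taylor_coeff]
  rw [Fintype.not_linearIndependent_iff]
  constructor
  · rintro ⟨c, ⟨i, hi, hci⟩, hc⟩
    refine ⟨fun i => c i / (i : ℕ).factorial, ?_, ⟨i, hi⟩, div_ne_zero hci (hfac i)⟩
    funext m
    have h := hc m
    rw [Finset.sum_range] at h
    rw [Finset.sum_apply, Pi.zero_apply, ← h]
    refine Finset.sum_congr rfl fun i _ => ?_
    have := hfac i
    fin_cases m <;> simp <;> field_simp
  · rintro ⟨g, hg, i, hi⟩
    refine ⟨fun k => if h : k < n + 1 then g ⟨k, h⟩ * k.factorial else 0,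
      ⟨i, i.2, by simpa [i.is_le] using ⟨hi, Nat.factorial_ne_zero _⟩⟩, fun m => ?_⟩
    have h := congrFun hg m
    rw [Finset.sum_apply, Pi.zero_apply] at h
    rw [Finset.sum_range, ← h]
    refine Finset.sum_congr rfl fun i _ => ?_
    fin_cases m <;> simp [i.is_le] <;> ring

theorem PowerSeries.coeff_X_mul_derivative (g : PowerSeries ℂ) (i : ℕ) :
    PowerSeries.coeff i (PowerSeries.X * PowerSeries.derivative ℂ g) =
      i * PowerSeries.coeff i g := by
  cases i with
  | zero => simp
  | succ i => rw [PowerSeries.coeff_succ_X_mul, PowerSeries.coeff_derivative]; push_cast; ring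

theorem Polynomial.coeff_X_mul_derivative (g : ℂ[X]) (i : ℕ) :
    (X * derivative g).coeff i = i * g.coeff i := by
  cases i with
  | zero => simp
  | succ i => rw [coeff_X_mul, coeff_derivative]; push_cast; ring

theorem Polynomial.taylor_derivative (z : ℂ) (p : ℂ[X]) :
    taylor z (derivative p) = derivative (taylor z p) := by
  simp [taylor_apply, derivative_comp]

/-- The local obstruction at the origin: a solution `b` that is not divisible by `X ^ (k + 1)`
forces a relation between the low order coefficients of the `F m`. -/
theorem exists_coeff_relation_of_solution {ι : Type*} {k : ℕ} {β μ : ℂ[X]} {b F : ι → ℂ[X]}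
    (hβ : β.coeff 0 ≠ 0) {m₀ : ι} (hF : (F m₀).coeff 0 ≠ 0)
    (h : ∀ m, X ^ (k + 1) * β * derivative (b m) - derivative (X ^ (k + 1) * β) * b m = μ * F m)
    (hb : ¬∀ m, X ^ (k + 1) ∣ b m) :
    ∃ c : ℕ → ℂ, (∃ i < k + 2, c i ≠ 0) ∧
      ∀ m, ∑ i ∈ Finset.range (k + 2), (F m).coeff i * c i = 0 := by
  set B : PowerSeries ℂ := (β : PowerSeries ℂ)⁻¹
  have hβ' : PowerSeries.constantCoeff (β : PowerSeries ℂ) ≠ 0 := by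
    rwa [← PowerSeries.coeff_zero_eq_constantCoeff_apply, coeff_coe]
  have hβB : (β : PowerSeries ℂ) * B = 1 := PowerSeries.mul_inv_cancel _ hβ'
  have hF' : PowerSeries.constantCoeff (F m₀ : PowerSeries ℂ) ≠ 0 := by
    rwa [← PowerSeries.coeff_zero_eq_constantCoeff_apply, coeff_coe]
  set g : ι → PowerSeries ℂ := fun m => B * b m with hg
  have hbg (m : ι) : (b m : PowerSeries ℂ) = β * g m := by
    rw [hg, ← mul_assoc, hβB, one_mul]
  have key (m : ι) : PowerSeries.X ^ k *
      (PowerSeries.X * PowerSeries.derivative ℂ (g m) - ((k + 1 : ℕ) : PowerSeries ℂ) * g m) =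
      B ^ 2 * (μ : PowerSeries ℂ) * (F m : PowerSeries ℂ) := by
    have h1 := congrArg (fun p : ℂ[X] => (p : PowerSeries ℂ)) (h m)
    simp only [coe_mul, coe_sub, coe_pow, coe_X, ← PowerSeries.derivative_coe, hbg,
      Derivation.leibniz, smul_eq_mul, PowerSeries.derivative_pow, PowerSeries.derivative_X,
      Nat.add_sub_cancel] at h1
    linear_combination B ^ 2 * h1 - ((β : PowerSeries ℂ) * B + 1) * PowerSeries.X ^ k *
      (PowerSeries.X * PowerSeries.derivative ℂ (g m) - ((k + 1 : ℕ) : PowerSeries ℂ) * g m) * hβB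
  obtain ⟨s, hs⟩ : PowerSeries.X ^ k ∣ B ^ 2 * (μ : PowerSeries ℂ) := by
    refine ⟨(PowerSeries.X * PowerSeries.derivative ℂ (g m₀) -
      ((k + 1 : ℕ) : PowerSeries ℂ) * g m₀) * (F m₀ : PowerSeries ℂ)⁻¹, ?_⟩
    rw [← mul_assoc, key, mul_assoc, PowerSeries.mul_inv_cancel _ hF', mul_one]
  have key' (m : ι) : PowerSeries.X * PowerSeries.derivative ℂ (g m) -
      ((k + 1 : ℕ) : PowerSeries ℂ) * g m = (F m : PowerSeries ℂ) * s := by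
    refine mul_left_cancel₀ (pow_ne_zero k PowerSeries.X_ne_zero) ?_
    rw [key, hs]; ring
  have hcoeff (m : ι) (i : ℕ) : ((i : ℂ) - (k + 1 : ℕ)) * PowerSeries.coeff i (g m) =
      PowerSeries.coeff i ((F m : PowerSeries ℂ) * s) := by
    rw [← key', map_sub, PowerSeries.coeff_X_mul_derivative, ← nsmul_eq_mul (k + 1) (g m),
      map_nsmul, nsmul_eq_mul]
    ring
  refine ⟨fun i => PowerSeries.coeff (k + 1 - i) s, ?_, fun m => ?_⟩
  · by_contra! hc
    have hs' : PowerSeries.X ^ (k + 2) ∣ s := by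
      rw [PowerSeries.X_pow_dvd_iff]
      intro i hi
      have := hc (k + 1 - i) (by omega)
      rwa [show k + 1 - (k + 1 - i) = i by omega] at this
    refine hb fun m => ?_
    rw [X_pow_dvd_iff]
    have hgd : PowerSeries.X ^ (k + 1) ∣ g m := by
      rw [PowerSeries.X_pow_dvd_iff]
      intro i hi
      have h0 : PowerSeries.coeff i ((F m : PowerSeries ℂ) * s) = 0 :=
        PowerSeries.X_pow_dvd_iff.1 (hs'.mul_left _) i (by omega)
      rw [← hcoeff] at h0
      refine (mul_eq_zero.1 h0).resolve_left (sub_ne_zero.2 ?_)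
      exact_mod_cast hi.ne
    intro i hi
    rw [← coeff_coe, hbg]
    exact PowerSeries.X_pow_dvd_iff.1 (hgd.mul_left _) i hi
  · have h0 := hcoeff m (k + 1)
    rw [sub_self, zero_mul, PowerSeries.coeff_mul,
      Finset.Nat.sum_antidiagonal_eq_sum_range_succ
        (fun i j => PowerSeries.coeff i (F m : PowerSeries ℂ) * PowerSeries.coeff j s)] at h0
    simpa using h0.symm

theorem exists_taylor_factor {α : ℂ[X]} (hα : α ≠ 0) (z : ℂ) :
    ∃ β, α = (X - C z) ^ rootMultiplicity z α * β ∧ β.eval z ≠ 0 := by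
  obtain ⟨β, h, hβ⟩ := exists_eq_pow_rootMultiplicity_mul_and_not_dvd α hα z
  exact ⟨β, h, fun h0 => hβ (dvd_iff_isRoot.2 h0)⟩

theorem exists_pow_not_dvd_of_not_dvd {α b : ℂ[X]} (hα : α ≠ 0) (h : ¬α ∣ b) :
    ∃ z, ¬(X - C z) ^ rootMultiplicity z α ∣ b := by
  classical
  have hb : b ≠ 0 := by rintro rfl; exact h (dvd_zero _)
  by_contra! hz
  refine h ((IsAlgClosed.dvd_iff_roots_le_roots hα hb).2 (Multiset.le_iff_count.2 fun z => ?_))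
  rw [count_roots, count_roots]
  exact (le_rootMultiplicity_iff hb).2 (hz z)

theorem taylor_dvd_taylor {z : ℂ} {p q : ℂ[X]} : taylor z p ∣ taylor z q ↔ p ∣ q :=
  map_dvd_iff (taylorEquiv z)

theorem exists_hasResidueRelation_of_solution {ι : Type*} {α μ : ℂ[X]} {b F : ι → ℂ[X]}
    (hα : α ≠ 0) (h : ∀ m, α * derivative (b m) - derivative α * b m = μ * F m)
    (hb : ¬∀ m, α ∣ b m) :
    ∃ z, 1 ≤ rootMultiplicity z α ∧ HasResidueRelation z (rootMultiplicity z α) F := by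
  obtain ⟨m₁, hm₁⟩ := not_forall.1 hb
  obtain ⟨z, hz⟩ := exists_pow_not_dvd_of_not_dvd hα hm₁
  obtain ⟨β, hαβ, hβ⟩ := exists_taylor_factor hα z
  refine ⟨z, Nat.one_le_iff_ne_zero.2 fun h0 => hz (by simp [h0]), ?_⟩
  by_cases hF : ∀ m, (F m).eval z = 0
  · exact hasResidueRelation_of_eval_eq_zero _ hF
  obtain ⟨m₀, hm₀⟩ := not_forall.1 hF
  obtain ⟨k, hk⟩ : ∃ k, rootMultiplicity z α = k + 1 :=
    Nat.exists_eq_succ_of_ne_zero fun h0 => hz (by simp [h0])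
  rw [hk] at hαβ hz ⊢
  have hTα : taylor z α = X ^ (k + 1) * taylor z β := by
    rw [hαβ, taylor_mul, taylor_pow, map_sub, taylor_X, taylor_C, add_sub_cancel_right]
  refine exists_coeff_relation_of_solution (β := taylor z β) (μ := taylor z μ)
    (b := fun m => taylor z (b m)) (m₀ := m₀) (by rwa [taylor_coeff_zero])
    (by rwa [taylor_coeff_zero]) (fun m => ?_) fun hd => hz ?_
  · rw [← hTα, ← taylor_derivative, ← taylor_derivative, ← taylor_mul, ← taylor_mul,
      ← taylor_mul, ← map_sub, h]
  · rw [← taylor_dvd_taylor (z := z), taylor_pow, map_sub, taylor_X, taylor_C,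
      add_sub_cancel_right]
    exact hd m₁

theorem exists_X_mul_derivative_sub_eq {n : ℕ} {p : ℂ[X]} (hp : p.coeff n = 0) :
    ∃ g : ℂ[X], X * derivative g - (n : ℂ[X]) * g = p := by
  refine ⟨∑ i ∈ p.support, monomial i (p.coeff i / ((i : ℂ) - n)), ?_⟩
  ext i
  rw [coeff_sub, coeff_X_mul_derivative, coeff_natCast_mul, ← sub_mul, finsetSum_coeff]
  simp only [coeff_monomial, Finset.sum_ite_eq', mem_support_iff, ne_eq, ite_not]
  split_ifs with h
  · simp [h]
  · refine mul_div_cancel₀ _ (sub_ne_zero.2 ?_)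
    intro hi
    exact h (Nat.cast_injective hi ▸ hp)

theorem exists_X_sub_C_mul_derivative_sub_eq {n : ℕ} {z : ℂ} {p : ℂ[X]}
    (hp : (taylor z p).coeff n = 0) :
    ∃ g : ℂ[X], (X - C z) * derivative g - (n : ℂ[X]) * g = p := by
  obtain ⟨g, hg⟩ := exists_X_mul_derivative_sub_eq hp
  obtain ⟨g, rfl⟩ := (taylorEquiv z).surjective g
  refine ⟨g, taylor_injective z ?_⟩
  have hn : taylor z (n : ℂ[X]) = n := map_natCast (taylorEquiv z) n
  rw [← hg, map_sub, taylor_mul, taylor_mul, taylor_derivative, map_sub, taylor_X, taylor_C,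
    add_sub_cancel_right, hn]
  rfl

theorem exists_solution_of_hasResidueRelation {ι : Type*} {α : ℂ[X]} {F : ι → ℂ[X]} {z : ℂ}
    (hα : α ≠ 0) (hz : 1 ≤ rootMultiplicity z α) {m₀ : ι} (hF : (F m₀).eval z ≠ 0)
    (h : HasResidueRelation z (rootMultiplicity z α) F) :
    ∃ (μ : ℂ[X]) (b : ι → ℂ[X]),
      (∀ m, α * derivative (b m) - derivative α * b m = μ * F m) ∧ ¬∀ m, α ∣ b m := by
  obtain ⟨β, hαβ, hβ⟩ := exists_taylor_factor hα z
  obtain ⟨k, hk⟩ := Nat.exists_eq_add_of_le' hz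
  rw [hk] at hαβ h
  obtain ⟨c, ⟨i₀, hi₀, hci₀⟩, hc⟩ := h
  set s₀ : ℂ[X] := ∑ j ∈ Finset.range (k + 2), monomial j (c (k + 1 - j)) with hs₀
  have hs₀c (j : ℕ) (hj : j < k + 2) : s₀.coeff j = c (k + 1 - j) := by
    simp [hs₀, coeff_monomial, hj]
  obtain ⟨s, hs⟩ := (taylorEquiv z).surjective s₀
  replace hs : taylor z s = s₀ := hs
  have hres (m : ι) : (taylor z (F m * s)).coeff (k + 1) = 0 := by
    rw [taylor_mul, hs, coeff_mul, Finset.Nat.sum_antidiagonal_eq_sum_range_succ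
      (fun i j => (taylor z (F m)).coeff i * s₀.coeff j), ← hc m]
    refine Finset.sum_congr rfl fun i hi => ?_
    have := Finset.mem_range.1 hi
    rw [hs₀c _ (by omega), show k + 1 - (k + 1 - i) = i by omega]
  choose g hg using fun m => exists_X_sub_C_mul_derivative_sub_eq (hres m)
  refine ⟨(X - C z) ^ k * β ^ 2 * s, fun m => β * g m, fun m => ?_, fun hd => ?_⟩
  · have := hg m
    simp only [hαβ, derivative_mul, derivative_pow, derivative_sub, derivative_X, derivative_C,
      Nat.add_sub_cancel, map_natCast] at this ⊢
    linear_combination (X - C z) ^ k * β ^ 2 * this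
  · have hβ0 : β ≠ 0 := by rintro rfl; simp at hβ
    have hgd : (X - C z) ^ (k + 1) ∣ g m₀ := by
      have := hd m₀
      rw [hαβ, mul_comm] at this
      exact (mul_dvd_mul_iff_left hβ0).1 this
    have hFs : (X - C z) ^ (k + 1) ∣ F m₀ * s := by
      obtain ⟨q, hq⟩ := hgd
      rw [← hg, hq]
      simp only [derivative_mul, derivative_pow, derivative_sub, derivative_X, derivative_C,
        Nat.add_sub_cancel, map_natCast]
      exact ⟨(X - C z) * derivative q, by ring⟩
    have hsd : (X - C z) ^ (k + 1) ∣ s := by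
      refine IsCoprime.dvd_of_dvd_mul_left (IsCoprime.pow_left ?_) hFs
      refine (irreducible_X_sub_C z).coprime_iff_not_dvd.2 fun hdvd => hF ?_
      exact dvd_iff_isRoot.1 hdvd
    rw [← taylor_dvd_taylor (z := z), taylor_pow, map_sub, taylor_X, taylor_C,
      add_sub_cancel_right, hs, X_pow_dvd_iff] at hsd
    have hc0 (i : ℕ) (hi : i < k + 1) : c (i + 1) = 0 := by
      have := hsd (k - i) (by omega)
      rwa [hs₀c _ (by omega), show k + 1 - (k - i) = i + 1 by omega] at this
    have hsum := hc m₀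
    rw [Finset.sum_range_succ', Finset.sum_eq_zero fun i hi => by
      rw [hc0 i (Finset.mem_range.1 hi), mul_zero], zero_add, taylor_coeff_zero] at hsum
    cases i₀ with
    | zero => exact (mul_ne_zero hF hci₀) hsum
    | succ i => exact hci₀ (hc0 i (by omega))

end LocalAnalysis

section RealForms

theorem exists_eq_toC_add (p : ℂ[X]) :
    ∃ a b : ℝ[X], p = toC a + C Complex.I * toC b := by
  induction p using Polynomial.induction_on' with
  | add p q hp hq =>
    obtain ⟨a, b, rfl⟩ := hp
    obtain ⟨a', b', rfl⟩ := hq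
    exact ⟨a + a', b + b', by simp only [map_add]; ring⟩
  | monomial n c =>
    refine ⟨monomial n c.re, monomial n c.im, ?_⟩
    simp only [toC, coe_mapRingHom, map_monomial, C_mul_monomial, ← map_add]
    congr 1
    simpa [mul_comm] using (Complex.re_add_im c).symm

theorem coeff_toC (p : ℝ[X]) (n : ℕ) : (toC p).coeff n = p.coeff n := by
  simp [toC]

theorem toC_add_inj {a b a' b' : ℝ[X]}
    (h : toC a + C Complex.I * toC b = toC a' + C Complex.I * toC b') : a = a' ∧ b = b' := by
  have hn (n : ℕ) := congrArg (fun p => p.coeff n) h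
  simp only [coeff_add, coeff_C_mul, coeff_toC] at hn
  constructor <;> ext n
  · simpa using congrArg Complex.re (hn n)
  · simpa using congrArg Complex.im (hn n)

theorem derivative_toC (p : ℝ[X]) : derivative (toC p) = toC (derivative p) :=
  derivative_map _ _

theorem toC_dvd_toC {p q : ℝ[X]} : toC p ∣ toC q ↔ p ∣ q :=
  map_dvd_map' _

/-- Solvability over `ℝ` with a non-polynomial quotient is equivalent to solvability over `ℂ`. -/
theorem exists_real_solution_iff {ι : Type*} (α : ℝ[X]) (F : ι → ℝ[X]) :
    (∃ (μ : ℝ[X]) (b : ι → ℝ[X]),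
      (∀ m, α * derivative (b m) - derivative α * b m = μ * F m) ∧ ¬∀ m, α ∣ b m) ↔
    ∃ (μ : ℂ[X]) (b : ι → ℂ[X]),
      (∀ m, toC α * derivative (b m) - derivative (toC α) * b m = μ * toC (F m)) ∧
        ¬∀ m, toC α ∣ b m := by
  constructor
  · rintro ⟨μ, b, h, hb⟩
    refine ⟨toC μ, fun m => toC (b m), fun m => ?_, by simpa only [toC_dvd_toC]⟩
    simp only [derivative_toC, ← map_mul, ← map_sub, h]
  · rintro ⟨μ, b, h, hb⟩
    obtain ⟨μ₁, μ₂, rfl⟩ := exists_eq_toC_add μ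
    choose b₁ b₂ hb₁₂ using fun m => exists_eq_toC_add (b m)
    have key (m : ι) := toC_add_inj (a := α * derivative (b₁ m) - derivative α * b₁ m)
      (b := α * derivative (b₂ m) - derivative α * b₂ m) (a' := μ₁ * F m) (b' := μ₂ * F m) (by
        have := h m
        simp only [hb₁₂, derivative_add, derivative_C_mul, derivative_toC] at this
        simp only [map_sub, map_mul]
        linear_combination this)
    by_cases h₁ : ∀ m, α ∣ b₁ m
    · refine ⟨μ₂, b₂, fun m => (key m).2, fun h₂ => hb fun m => ?_⟩
      rw [hb₁₂]
      exact dvd_add (toC_dvd_toC.2 (h₁ m)) ((toC_dvd_toC.2 (h₂ m)).mul_left _)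
    · exact ⟨μ₁, b₁, fun m => (key m).1, h₁⟩

end RealForms

section ComplexComponents

@[simp] theorem qi_components : qi.re = 0 ∧ qi.imI = 1 ∧ qi.imJ = 0 ∧ qi.imK = 0 :=
  ⟨rfl, rfl, rfl, rfl⟩

@[simp] theorem qj_components : qj.re = 0 ∧ qj.imI = 0 ∧ qj.imJ = 1 ∧ qj.imK = 0 :=
  ⟨rfl, rfl, rfl, rfl⟩

@[simp] theorem qk_components : qk.re = 0 ∧ qk.imI = 0 ∧ qk.imJ = 0 ∧ qk.imK = 1 :=
  ⟨rfl, rfl, rfl, rfl⟩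

/-- Embedding of complex polynomials as quaternion polynomials with coefficients `x + y * i`. -/
def complexToQ : ℂ[X] →+* (Quaternion ℝ)[X] :=
  mapRingHom (Quaternion.ofComplex : ℂ →ₐ[ℝ] Quaternion ℝ).toRingHom

/-- Coefficientwise conjugation of a complex polynomial. -/
def complexConj : ℂ[X] →+* ℂ[X] :=
  mapRingHom (starRingEnd ℂ)

theorem coeff_complexToQ (P : ℂ[X]) (n : ℕ) :
    (complexToQ P).coeff n = Quaternion.coeComplex (P.coeff n) := by
  simp [complexToQ]

theorem coeff_pconj (A : (Quaternion ℝ)[X]) (n : ℕ) : (pconj A).coeff n = star (A.coeff n) := by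
  simp +contextual [pconj, Polynomial.sum, finsetSum_coeff, coeff_monomial]

theorem exists_eq_complexToQ_add (A : (Quaternion ℝ)[X]) :
    ∃ P Q : ℂ[X], A = complexToQ P + C qj * complexToQ Q := by
  induction A using Polynomial.induction_on' with
  | add p q hp hq =>
    obtain ⟨P, Q, rfl⟩ := hp
    obtain ⟨P', Q', rfl⟩ := hq
    exact ⟨P + P', Q + Q', by simp only [map_add, mul_add]; abel⟩
  | monomial n a =>
    refine ⟨monomial n ⟨a.re, a.imI⟩, monomial n ⟨a.imJ, -a.imK⟩, ?_⟩
    simp only [complexToQ, coe_mapRingHom, map_monomial, C_mul_monomial, ← map_add]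
    congr 1
    ext <;> simp

theorem complexToQ_add_inj {P Q P' Q' : ℂ[X]}
    (h : complexToQ P + C qj * complexToQ Q = complexToQ P' + C qj * complexToQ Q') :
    P = P' ∧ Q = Q' := by
  have hn (n : ℕ) := congrArg (fun p => p.coeff n) h
  simp only [coeff_add, coeff_C_mul, coeff_complexToQ] at hn
  constructor <;> ext n <;> apply Complex.ext
  · simpa using congrArg (·.re) (hn n)
  · simpa using congrArg (·.imI) (hn n)
  · simpa using congrArg (·.imJ) (hn n)
  · simpa using congrArg (·.imK) (hn n)

theorem pconj_complexToQ_add (P Q : ℂ[X]) :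
    pconj (complexToQ P + C qj * complexToQ Q) =
      complexToQ (complexConj P) - C qj * complexToQ Q := by
  ext n <;> simp [coeff_pconj, coeff_complexToQ, complexConj]

theorem complexToQ_mul_qj (P : ℂ[X]) :
    complexToQ P * C qj = C qj * complexToQ (complexConj P) := by
  ext n <;> simp [coeff_complexToQ, complexConj]

theorem complexToQ_C_I : complexToQ (C Complex.I) = C qi := by
  simp only [complexToQ, coe_mapRingHom, map_C]
  rfl

theorem complexToQ_toC (p : ℝ[X]) : complexToQ (toC p) = toQ p := by
  ext n <;> simp [coeff_complexToQ, coeff_toC, toQ]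

theorem complexConj_toC (p : ℝ[X]) : complexConj (toC p) = toC p := by
  ext n; simp [complexConj, coeff_toC]

theorem complexConj_complexConj (P : ℂ[X]) : complexConj (complexConj P) = P := by
  ext n; simp [complexConj]

theorem complexConj_C_I : complexConj (C Complex.I) = -C Complex.I := by
  simp [complexConj]

theorem eval_complexConj (P : ℂ[X]) (z : ℂ) :
    (complexConj P).eval z = starRingEnd ℂ (P.eval (starRingEnd ℂ z)) := by
  have h := eval_map_apply (f := starRingEnd ℂ) (p := P) (x := starRingEnd ℂ z)
  rw [Complex.conj_conj] at h
  exact h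

/-- The components of `A * i * Ā` in terms of the complex components of `A = P + j * Q`. -/
theorem components_eq {P Q : ℂ[X]} {F₁ F₂ F₃ : ℝ[X]}
    (h : (complexToQ P + C qj * complexToQ Q) * C qi * pconj (complexToQ P + C qj * complexToQ Q) =
      toQ F₁ * C qi + toQ F₂ * C qj + toQ F₃ * C qk) :
    toC F₁ = P * complexConj P - Q * complexConj Q ∧
      toC F₂ - C Complex.I * toC F₃ = 2 * C Complex.I * (Q * complexConj P) := by
  have hjj : (C qj : (Quaternion ℝ)[X]) * C qj = -1 := by
    have h : qj * qj = -1 := by ext <;> simp <;> rfl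
    rw [← C_mul, h, C_neg, C_1]
  have hk : (C qk : (Quaternion ℝ)[X]) = -(C qj * C qi) := by
    rw [← C_mul, ← C_neg]; congr 1; ext <;> simp
  have hjPj (R S : ℂ[X]) : (C qj * complexToQ R) * (C qj * complexToQ S) =
      -complexToQ (complexConj R * S) := by
    rw [mul_assoc, ← mul_assoc (complexToQ R), complexToQ_mul_qj, ← mul_assoc, ← mul_assoc, hjj,
      map_mul]
    noncomm_ring
  have hPj (R S : ℂ[X]) : complexToQ R * (C qj * complexToQ S) =
      C qj * complexToQ (complexConj R * S) := by
    rw [← mul_assoc, complexToQ_mul_qj, mul_assoc, map_mul]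
  have hL : (complexToQ P + C qj * complexToQ Q) * C qi *
      pconj (complexToQ P + C qj * complexToQ Q) =
      complexToQ (C Complex.I * (P * complexConj P - Q * complexConj Q)) +
        C qj * complexToQ (2 * C Complex.I * (Q * complexConj P)) := by
    rw [pconj_complexToQ_add, ← complexToQ_C_I, add_mul, mul_assoc (C qj), ← map_mul, ← map_mul,
      add_mul, mul_sub, mul_sub, hPj, hjPj, mul_assoc (C qj), ← map_mul, ← map_mul]
    rw [show C Complex.I * (P * complexConj P - Q * complexConj Q) =
          P * C Complex.I * complexConj P + complexConj (Q * C Complex.I) * Q by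
        rw [map_mul, complexConj_C_I]; ring,
      show 2 * C Complex.I * (Q * complexConj P) =
          Q * C Complex.I * complexConj P - complexConj (P * C Complex.I) * Q by
        rw [map_mul, complexConj_C_I]; ring, map_add, map_sub, mul_sub]
    abel
  have hR : toQ F₁ * C qi + toQ F₂ * C qj + toQ F₃ * C qk =
      complexToQ (C Complex.I * toC F₁) + C qj * complexToQ (toC F₂ - C Complex.I * toC F₃) := by
    simp only [hk, ← complexToQ_toC, ← complexToQ_C_I, mul_neg, complexToQ_mul_qj, hPj,
      complexConj_toC, map_sub, mul_sub]
    rw [← map_mul, mul_comm (toC F₁), mul_comm (C Complex.I) (toC F₃)]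
    abel
  rw [hL, hR] at h
  obtain ⟨h₁, h₂⟩ := complexToQ_add_inj h
  exact ⟨(mul_left_cancel₀ (by simp) h₁).symm, h₂.symm⟩

/-- A common root of the complex components of `A` yields a linear right factor of `A`. -/
theorem not_reducedWrtI_of_common_root {P Q : ℂ[X]} {w : ℂ} (hP : P.eval w = 0)
    (hQ : Q.eval w = 0) : ¬ReducedWrtI (complexToQ P + C qj * complexToQ Q) := by
  rintro ⟨-, h⟩
  obtain ⟨P', rfl⟩ := dvd_iff_isRoot.2 hP
  obtain ⟨Q', rfl⟩ := dvd_iff_isRoot.2 hQ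
  have := h (complexToQ P' + C qj * complexToQ Q') (complexToQ (X - C w))
    (by rw [mul_comm _ P', mul_comm _ Q', map_mul, map_mul, add_mul, mul_assoc])
    (fun n => by simp [coeff_complexToQ])
  have hdeg : (complexToQ (X - C w)).natDegree = (X - C w).natDegree :=
    natDegree_map_eq_of_injective (Quaternion.ofComplex : ℂ →ₐ[ℝ] Quaternion ℝ).toRingHom.injective _
  rw [hdeg, natDegree_X_sub_C] at this
  exact one_ne_zero this

/-- If `A` is reduced, the components of `A * i * Ā` have no common complex root. -/
theorem ReducedWrtI.not_common_root {A : (Quaternion ℝ)[X]} (hred : ReducedWrtI A)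
    {F₁ F₂ F₃ : ℝ[X]}
    (hF : A * C qi * pconj A = toQ F₁ * C qi + toQ F₂ * C qj + toQ F₃ * C qk) (z : ℂ) :
    ¬((toC F₁).eval z = 0 ∧ (toC F₂).eval z = 0 ∧ (toC F₃).eval z = 0) := by
  rintro ⟨h₁, h₂, h₃⟩
  obtain ⟨P, Q, rfl⟩ := exists_eq_complexToQ_add A
  obtain ⟨e₁, e₂⟩ := components_eq hF
  have e₃ := congrArg complexConj e₂
  simp only [map_sub, map_mul, complexConj_toC, complexConj_C_I, complexConj_complexConj,
    map_ofNat] at e₃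
  have f₁ := congrArg (eval z) e₁
  have f₂ := congrArg (eval z) e₂
  have f₃ := congrArg (eval z) e₃
  simp [h₁, h₂, h₃] at f₁ f₂ f₃
  have hbar (R : ℂ[X]) (hR : (complexConj R).eval z = 0) : R.eval (starRingEnd ℂ z) = 0 := by
    rwa [eval_complexConj, map_eq_zero] at hR
  by_cases hP : P.eval z = 0
  · by_cases hQ : Q.eval z = 0
    · exact not_reducedWrtI_of_common_root hP hQ hred
    · have hcQ : (complexConj Q).eval z = 0 := by simpa [hP, hQ] using f₁
      have hcP : (complexConj P).eval z = 0 := by simpa [hQ] using f₂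
      exact not_reducedWrtI_of_common_root (hbar _ hcP) (hbar _ hcQ) hred
  · have hcQ : (complexConj Q).eval z = 0 := by simpa [hP] using f₃
    have hcP : (complexConj P).eval z = 0 := by simpa [hP, hcQ] using f₁
    exact not_reducedWrtI_of_common_root (hbar _ hcP) (hbar _ hcQ) hred

end ComplexComponents

/-- Write `A i Ā = F₁·i + F₂·j + F₃·k`.  The following are equivalent:
(1) there exist `μ, b₁, b₂, b₃ ∈ ℝ[t]` with `α·b_m′ − α′·b_m = μ·F_m` for `m = 1, 2, 3` and
not all `b_m` divisible by `α` (so that the trajectory `−2b/α` is a non-polynomial rational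
PH curve);
(2) there is a root `z ∈ ℂ` of `α` of multiplicity `n ≥ 1` such that the `n + 1` vectors
`(F₁⁽ⁱ⁾(z), F₂⁽ⁱ⁾(z), F₃⁽ⁱ⁾(z)) ∈ ℂ³`, `i = 0, …, n`, are linearly dependent over `ℂ`. -/
theorem nonpolynomial_solutions_characterization (α : Polynomial ℝ) (hα : α ≠ 0)
    (A : Polynomial (Quaternion ℝ)) (hA : A ≠ 0) (hred : ReducedWrtI A)
    (F₁ F₂ F₃ : Polynomial ℝ)
    (hF : A * Polynomial.C qi * pconj A
      = toQ F₁ * Polynomial.C qi + toQ F₂ * Polynomial.C qj + toQ F₃ * Polynomial.C qk) :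
    (∃ μ b₁ b₂ b₃ : Polynomial ℝ,
      α * derivative b₁ - derivative α * b₁ = μ * F₁ ∧
      α * derivative b₂ - derivative α * b₂ = μ * F₂ ∧
      α * derivative b₃ - derivative α * b₃ = μ * F₃ ∧
      ¬(α ∣ b₁ ∧ α ∣ b₂ ∧ α ∣ b₃)) ↔
    (∃ z : ℂ, 1 ≤ rootMultiplicity z (toC α) ∧
      ¬LinearIndependent ℂ (fun i : Fin (rootMultiplicity z (toC α) + 1) =>
        ![((fun p => derivative p)^[(i : ℕ)] (toC F₁)).eval z,
          ((fun p => derivative p)^[(i : ℕ)] (toC F₂)).eval z,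
          ((fun p => derivative p)^[(i : ℕ)] (toC F₃)).eval z])) := by
  have h₁ := exists_real_solution_iff α ![F₁, F₂, F₃]
  have hvec : (fun m => toC (![F₁, F₂, F₃] m)) = ![toC F₁, toC F₂, toC F₃] := by
    funext m; fin_cases m <;> rfl
  have hα' : toC α ≠ 0 := (Polynomial.map_ne_zero_iff (algebraMap ℝ ℂ).injective).2 hα
  simp only [← hasResidueRelation_iff_not_linearIndependent, ← hvec]
  trans ∃ (μ : ℝ[X]) (b : Fin 3 → ℝ[X]),
    (∀ m, α * derivative (b m) - derivative α * b m = μ * ![F₁, F₂, F₃] m) ∧ ¬∀ m, α ∣ b m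
  · constructor
    · rintro ⟨μ, b₁, b₂, b₃, e₁, e₂, e₃, h⟩
      exact ⟨μ, ![b₁, b₂, b₃], by simp [Fin.forall_fin_succ, e₁, e₂, e₃],
        by simpa [Fin.forall_fin_succ] using h⟩
    · rintro ⟨μ, b, e, h⟩
      exact ⟨μ, b 0, b 1, b 2, e 0, e 1, e 2, by simpa [Fin.forall_fin_succ] using h⟩
  rw [h₁]
  constructor
  · rintro ⟨μ, b, e, h⟩
    exact exists_hasResidueRelation_of_solution hα' e h
  · rintro ⟨z, hz, h⟩
    obtain ⟨m₀, hm₀⟩ : ∃ m, (toC (![F₁, F₂, F₃] m)).eval z ≠ 0 := by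
      by_contra! h0
      exact hred.not_common_root hF z ⟨h0 0, h0 1, h0 2⟩
    exact exists_solution_of_hasResidueRelation hα' hz hm₀ h
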